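/- arXiv:2603.20715 — 2 statements merged into one kernel-verified Lean document; each statement's English description precedes it below -/
import Mathlib

section
/- Let a_1, …, a_N ∈ ℤ^n, let σ ⊆ {1, …, N} be a subset with exactly n elements such that (a_i)_{i ∈ σ} is linearly independent, and let w = (w_1, …, w_N) ∈ ℝ^N be such that σ belongs to the regular subdivision S(w). Then for every function p : ({1, …, N} \ σ) → ℤ and every k ∈ ℝ, the set { u = (u_1, …, u_N) ∈ ℤ^N : u_1 a_1 + … + u_N a_N = 0, w_1 u_1 + … + w_N u_N ≤ k, and u_j ≥ −p_j for all j ∉ σ } is finite. -/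
open scoped BigOperators

/-- Membership of a subset `σ` in the regular subdivision `S(w)` of the point
configuration `a : ι → (Fin n → ℝ)` with weight vector `w`. -/
def memSubdiv {ι : Type*} {n : ℕ} (a : ι → Fin n → ℝ) (w : ι → ℝ) (σ : Finset ι) : Prop :=
  ∃ m : Fin n → ℝ,
    (∀ i ∈ σ, ∑ k, m k * a i k = w i) ∧ ∀ j, j ∉ σ → ∑ k, m k * a j k < w j

/-- Finiteness of the truncation of the Gamma series attached to a simplex `σ` of a
regular triangulation: the set of lattice relations `u` with bounded `w`-weight and
bounded below outside `σ` is finite. -/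
theorem stmt3 {N n : ℕ} (a : Fin N → Fin n → ℤ) (σ : Finset (Fin N))
    (hcard : σ.card = n)
    (hind : LinearIndependent ℝ (fun i : σ => fun k => (a i k : ℝ)))
    (w : Fin N → ℝ) (hσ : memSubdiv (fun j i => (a j i : ℝ)) w σ)
    (p : {j : Fin N // j ∉ σ} → ℤ) (k : ℝ) :
    {u : Fin N → ℤ |
      (∀ i : Fin n, ∑ j, u j * a j i = 0) ∧
      (∑ j, w j * (u j : ℝ)) ≤ k ∧
      ∀ j (hj : j ∉ σ), -p ⟨j, hj⟩ ≤ u j}.Finite := by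
  classical
  obtain ⟨m, hm1, hm2⟩ := hσ
  set c : Fin N → ℝ := fun j => w j - ∑ i, m i * (a j i : ℝ) with hc
  have hc0 : ∀ j ∈ σ, c j = 0 := fun j hj => by
    have := hm1 j hj
    simp only [hc]; linarith
  have hcpos : ∀ j, j ∉ σ → 0 < c j := fun j hj => by
    have := hm2 j hj
    simp only [hc]; linarith
  let P : Fin N → ℤ := fun j => if hj : j ∉ σ then p ⟨j, hj⟩ else 0
  have hP : ∀ j (hj : j ∉ σ), P j = p ⟨j, hj⟩ := fun j hj => by simp [P, hj]
  let K : ℝ := k + ∑ j, c j * (P j : ℝ)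
  let f : (Fin N → ℤ) → ({j : Fin N // j ∉ σ} → ℤ) := fun u j => u j
  apply Set.Finite.of_finite_image (f := f)
  · apply (Set.finite_Icc (fun j => - p j) (fun j => ⌊K / c j - p j⌋)).subset
    rintro _ ⟨u, ⟨hu1, hu2, hu3⟩, rfl⟩
    refine ⟨fun j => hu3 j j.2, fun j => ?_⟩
    have hrel : ∑ j, (∑ i, m i * (a j i : ℝ)) * (u j : ℝ) = 0 := by
      simp_rw [Finset.sum_mul]
      rw [Finset.sum_comm]
      apply Finset.sum_eq_zero
      intro i _
      have h : ∑ j, (u j : ℝ) * (a j i : ℝ) = 0 := by exact_mod_cast hu1 i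
      calc ∑ j, m i * (a j i : ℝ) * (u j : ℝ) = m i * ∑ j, (u j : ℝ) * (a j i : ℝ) := by
            rw [Finset.mul_sum]; exact Finset.sum_congr rfl fun _ _ => by ring
        _ = 0 := by rw [h, mul_zero]
    have hsum : ∑ j, c j * ((u j : ℝ) + P j) ≤ K := by
      have : ∑ j, c j * ((u j : ℝ) + P j) = ∑ j, w j * (u j : ℝ)
          - ∑ j, (∑ i, m i * (a j i : ℝ)) * (u j : ℝ) + ∑ j, c j * (P j : ℝ) := by
        rw [← Finset.sum_sub_distrib, ← Finset.sum_add_distrib]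
        exact Finset.sum_congr rfl fun _ _ => by simp only [hc]; ring
      rw [this, hrel]
      simp only [K]; linarith
    have hnn : ∀ i ∈ Finset.univ, 0 ≤ c i * ((u i : ℝ) + P i) := by
      intro i _
      by_cases hi : i ∈ σ
      · rw [hc0 i hi, zero_mul]
      · apply mul_nonneg (hcpos i hi).le
        have h := hu3 i hi
        rw [← hP i hi] at h
        have h' : 0 ≤ u i + P i := by linarith
        exact_mod_cast h'
    have hle := (Finset.single_le_sum hnn (Finset.mem_univ j.1)).trans hsum
    rw [hP j.1 j.2] at hle
    change u j ≤ ⌊K / c j - p j⌋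
    rw [Int.le_floor, le_sub_iff_add_le, le_div_iff₀ (hcpos j j.2)]
    linarith
  · rintro u ⟨hu1, -, -⟩ v ⟨hv1, -, -⟩ huv
    have hoff : ∀ j, j ∉ σ → u j = v j := fun j hj => congrFun huv ⟨j, hj⟩
    have hz := Fintype.linearIndependent_iff.1 hind (fun i => (u i : ℝ) - v i) (by
      ext i
      simp only [Finset.sum_apply, Pi.smul_apply, smul_eq_mul, Pi.zero_apply]
      rw [Finset.sum_coe_sort σ (fun j => ((u j : ℝ) - v j) * (a j i : ℝ))]
      rw [Finset.sum_subset (Finset.subset_univ σ)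
        (fun j _ hj => by rw [hoff j hj, sub_self, zero_mul])]
      simp_rw [sub_mul]
      rw [Finset.sum_sub_distrib]
      have h1 : ∑ j, (u j : ℝ) * (a j i : ℝ) = 0 := by exact_mod_cast hu1 i
      have h2 : ∑ j, (v j : ℝ) * (a j i : ℝ) = 0 := by exact_mod_cast hv1 i
      rw [h1, h2, sub_zero])
    funext j
    by_cases hj : j ∈ σ
    · have := hz ⟨j, hj⟩
      exact_mod_cast sub_eq_zero.1 this
    · exact hoff j hj
end

section
/- Let 0 < p < q be coprime integers and let ψ(x) := Γ'(x)/Γ(x) denote the digamma function (the derivative of the real Gamma function divided by the Gamma function). Then ψ(p/q) − ψ(1) = −log q − (π/2)·(cos(πp/q)/sin(πp/q)) + (1/2)·∑_{j=1}^{q−1} cos(2πjp/q)·log(2 − 2cos(2πj/q)). -/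
open scoped BigOperators Real

open Filter Topology in
lemma aux_psi_series (x : ℝ) (hx : 0 < x) (hx1 : x ≤ 1) :
    Tendsto (fun n : ℕ => ∑ k ∈ Finset.range n, (1 / ((k : ℝ) + 1) - 1 / (k + x))) atTop
      (𝓝 (deriv Real.Gamma x / Real.Gamma x - deriv Real.Gamma 1 / Real.Gamma 1)) := by
  let f := Real.log ∘ Real.Gamma
  have hc : ConvexOn ℝ (Set.Ioi 0) f := Real.convexOn_log_Gamma
  have h_rec (x : ℝ) (hx : 0 < x) : f (x + 1) = f x + Real.log x := by
    simp only [f, Function.comp_apply,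
      Real.Gamma_add_one hx.ne', Real.log_mul hx.ne' (Real.Gamma_pos_of_pos hx).ne', add_comm]
  have hder {x : ℝ} (hx : 0 < x) : DifferentiableAt ℝ f x := by
    refine ((Real.differentiableAt_Gamma ?_).log (Real.Gamma_ne_zero ?_)) <;>
    exact fun m ↦ ne_of_gt (by linarith [(Nat.cast_nonneg m : (0:ℝ) ≤ m)])
  have hder_rec (x : ℝ) (hx : 0 < x) : deriv f (x + 1) = deriv f x + 1 / x := by
    rw [← deriv_comp_add_const, one_div, ← Real.deriv_log,
      ← deriv_add (hder <| by positivity) (Real.differentiableAt_log hx.ne')]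
    apply EventuallyEq.deriv_eq
    filter_upwards [eventually_gt_nhds hx] using h_rec
  have hpsi {x : ℝ} (hx : 0 < x) : deriv Real.Gamma x / Real.Gamma x = deriv f x := by
    rw [show f = fun y => Real.log (Real.Gamma y) from rfl,
      deriv.log (Real.differentiableAt_Gamma (fun m ↦ ne_of_gt
        (by linarith [(Nat.cast_nonneg m : (0:ℝ) ≤ m)]))) (Real.Gamma_pos_of_pos hx).ne']
  have hsum (x : ℝ) (hx : 0 < x) (n : ℕ) :
      deriv f (n + x) = deriv f x + ∑ k ∈ Finset.range n, 1 / ((k : ℝ) + x) := by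
    induction n with
    | zero => simp
    | succ n ih =>
      rw [Finset.sum_range_succ, ← add_assoc, ← ih, ← hder_rec _ (by positivity)]
      congr 1
      push_cast; ring
  have hmono : MonotoneOn (deriv f) (Set.Ioi 0) := hc.monotoneOn_deriv (fun x hx => hder hx)
  rw [hpsi hx, hpsi one_pos]
  have heq : ∀ n : ℕ, ∑ k ∈ Finset.range n, (1 / ((k : ℝ) + 1) - 1 / (k + x)) =
      (deriv f x - deriv f 1) + (deriv f (n + 1) - deriv f (n + x)) := by
    intro n
    rw [hsum x hx, hsum 1 one_pos, Finset.sum_sub_distrib]; ring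
  simp_rw [heq]
  have h0 : Tendsto (fun n : ℕ => deriv f ((n : ℝ) + 1) - deriv f (n + x)) atTop (𝓝 0) := by
    refine tendsto_of_tendsto_of_tendsto_of_le_of_le' tendsto_const_nhds
      tendsto_one_div_atTop_nhds_zero_nat ?_ ?_
    · filter_upwards with n
      have := hmono (a := n + x) (b := n + 1) (by simp; positivity) (by simp; positivity)
        (by linarith)
      linarith
    · filter_upwards [eventually_gt_atTop 0] with n hn
      have hn' : (0 : ℝ) < n := by exact_mod_cast hn
      have := hmono (a := n) (b := n + x) (by simpa) (by simp; positivity) (by linarith)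
      rw [hder_rec _ hn']
      linarith
  simpa using h0.const_add (deriv f x - deriv f 1)

open Filter Topology in
lemma aux_circle (z : ℂ) (hz : ‖z‖ = 1) (hz1 : z ≠ 1) :
    Tendsto (fun n : ℕ => ∑ i ∈ Finset.range n, z ^ (i + 1) / ((i : ℂ) + 1)) atTop
      (𝓝 (-Complex.log (1 - z))) := by
  have hsub : z - 1 ≠ 0 := sub_ne_zero.mpr hz1
  have hC : CauchySeq fun n : ℕ ↦ ∑ i ∈ Finset.range n, (1 / ((i : ℝ) + 1)) • z ^ (i + 1) := by
    refine Antitone.cauchySeq_series_mul_of_tendsto_zero_of_bounded (b := 2 / ‖z - 1‖) ?_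
      tendsto_one_div_add_atTop_nhds_zero_nat ?_
    · intro a b hab
      have : (a : ℝ) ≤ b := by exact_mod_cast hab
      simp only
      gcongr
    · intro n
      simp_rw [pow_succ]
      rw [← Finset.sum_mul, geom_sum_eq hz1, norm_mul, hz, mul_one, norm_div]
      gcongr
      refine (norm_sub_le _ _).trans ?_
      rw [norm_pow, hz]; norm_num
  obtain ⟨l, hl⟩ := cauchySeq_tendsto_of_complete hC
  have hl' : Tendsto (fun n : ℕ => ∑ i ∈ Finset.range n, z ^ (i + 1) / ((i : ℂ) + 1)) atTop
      (𝓝 l) := by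
    refine hl.congr fun n => Finset.sum_congr rfl fun i _ => ?_
    rw [Complex.real_smul]; push_cast; ring
  have hA := Complex.tendsto_tsum_powerSeries_nhdsWithin_lt hl'
  rw [tendsto_map'_iff] at hA
  have hslit : 1 - z ∈ Complex.slitPlane := by
    left
    have h1 : z.re ≤ 1 := hz ▸ Complex.re_le_norm z
    have h2 : z.re ≠ 1 := by
      intro h
      have h3 := Complex.sq_norm_sub_sq_re z
      rw [hz, h] at h3
      apply hz1
      apply Complex.ext
      · simpa using h
      · have : z.im ^ 2 = 0 := by linarith
        simpa using this
    have := lt_of_le_of_ne h1 h2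
    simp; linarith
  have hB : Tendsto (fun t : ℝ => -Complex.log (1 - z * t) / t) (𝓝[<] 1)
      (𝓝 (-Complex.log (1 - z))) := by
    have : ContinuousAt (fun t : ℝ => -Complex.log (1 - z * t) / t) 1 := by
      refine ContinuousAt.div (ContinuousAt.neg (ContinuousAt.clog ?_ ?_)) ?_ ?_
      · fun_prop
      · simpa using hslit
      · fun_prop
      · simp
    have := this.tendsto
    simp only [Complex.ofReal_one, mul_one, div_one] at this
    exact this.mono_left nhdsWithin_le_nhds
  have hE : l = -Complex.log (1 - z) := by
    refine tendsto_nhds_unique hA (hB.congr' ?_)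
    filter_upwards [Ioo_mem_nhdsLT (zero_lt_one (α := ℝ))] with t ht
    have h1 : ‖z * t‖ < 1 := by
      rw [norm_mul, hz, one_mul, Complex.norm_real, Real.norm_eq_abs, abs_of_pos ht.1]
      exact ht.2
    have h2 := (Complex.hasSum_taylorSeries_neg_log' h1).div_const (t : ℂ)
    rw [← h2.tsum_eq]
    refine tsum_congr fun n => ?_
    have : (t : ℂ) ≠ 0 := by exact_mod_cast ht.1.ne'
    have : (n : ℂ) + 1 ≠ 0 := by exact_mod_cast n.succ_ne_zero
    field_simp
    ring
  exact hE ▸ hl'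

lemma aux_block (q : ℕ) (F : ℕ → ℂ) (M : ℕ) : ∑ i ∈ Finset.range (M * q), F i =
    ∑ n ∈ Finset.range M, ∑ r ∈ Finset.range q, F (n * q + r) := by
  induction M with
  | zero => simp
  | succ M ih => rw [Finset.sum_range_succ, ← ih, Nat.succ_mul, Finset.sum_range_add]

lemma aux_orth (q : ℕ) (w : ℂ) (hw : IsPrimitiveRoot w q) (m : ℕ) :
    ∑ j ∈ Finset.range q, w ^ (j * m) = if q ∣ m then (q : ℂ) else 0 := by
  simp_rw [mul_comm _ m, pow_mul]
  split_ifs with h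
  · rw [(hw.pow_eq_one_iff_dvd m).mpr h]; simp
  · have h1 : w ^ m ≠ 1 := fun h' => h ((hw.pow_eq_one_iff_dvd m).mp h')
    rw [geom_sum_eq h1, ← pow_mul, mul_comm, pow_mul, hw.pow_eq_one]; simp

open Filter Topology in
lemma aux_main (p q : ℕ) (hp : 0 < p) (hpq : p < q) (w : ℂ) (hw : IsPrimitiveRoot w q) :
    ((deriv Real.Gamma (p / q) / Real.Gamma (p / q) - deriv Real.Gamma 1 / Real.Gamma 1 : ℝ) : ℂ)
      = ∑ j ∈ Finset.range q, (1 - w ^ (j * (q - p))) * -Complex.log (1 - w ^ j) := by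
  have hq : 0 < q := by omega
  have hq' : (0 : ℝ) < q := by exact_mod_cast hq
  have hp' : (0 : ℝ) < p := by exact_mod_cast hp
  have hpq' : (p : ℝ) < q := by exact_mod_cast hpq
  have hlim : Tendsto (fun N : ℕ => ∑ j ∈ Finset.range q, (1 - w ^ (j * (q - p))) *
      ∑ i ∈ Finset.range N, (w ^ j) ^ (i + 1) / ((i : ℂ) + 1)) atTop
      (𝓝 (∑ j ∈ Finset.range q, (1 - w ^ (j * (q - p))) * -Complex.log (1 - w ^ j))) := by
    refine tendsto_finsetSum _ fun j hj => ?_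
    rcases Nat.eq_zero_or_pos j with rfl | hj0
    · simp
    · refine (aux_circle _ ?_ ?_).const_mul _
      · rw [norm_pow, hw.norm'_eq_one hq.ne', one_pow]
      · exact hw.pow_ne_one_of_pos_of_lt hj0.ne' (Finset.mem_range.mp hj)
  have hlim2 := hlim.comp (tendsto_id.atTop_mul_const' hq)
  have hS := aux_psi_series (p / q) (by positivity) ((div_le_one hq').mpr hpq'.le)
  have hS' := (Complex.continuous_ofReal.tendsto _).comp hS
  refine tendsto_nhds_unique hS' (hlim2.congr fun M => ?_)
  simp only [Function.comp, id]
  simp_rw [Finset.mul_sum]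
  rw [Finset.sum_comm]
  have key : ∀ i : ℕ, ∑ j ∈ Finset.range q, (1 - w ^ (j * (q - p))) *
      ((w ^ j) ^ (i + 1) / ((i : ℂ) + 1)) =
      ((if q ∣ i + 1 then (q : ℂ) else 0) - if q ∣ (q - p) + (i + 1) then (q : ℂ) else 0)
        / ((i : ℂ) + 1) := by
    intro i
    rw [← aux_orth q w hw, ← aux_orth q w hw, ← Finset.sum_sub_distrib, Finset.sum_div]
    refine Finset.sum_congr rfl fun j _ => ?_
    rw [mul_add j (q - p), pow_add, ← pow_mul]; ring
  simp_rw [key]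
  rw [aux_block]
  push_cast
  refine Finset.sum_congr rfl fun n _ => ?_
  have key2 : ∀ r ∈ Finset.range q,
      ((if q ∣ n * q + r + 1 then (q : ℂ) else 0) -
        if q ∣ (q - p) + (n * q + r + 1) then (q : ℂ) else 0) / ((n : ℂ) * q + r + 1) =
      (if r = q - 1 then (q : ℂ) / ((n : ℂ) * q + r + 1) else 0) -
      (if r = p - 1 then (q : ℂ) / ((n : ℂ) * q + r + 1) else 0) := by
    intro r hr
    have hr := Finset.mem_range.mp hr
    have e1 : q ∣ n * q + r + 1 ↔ r = q - 1 := by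
      rw [add_assoc, Nat.dvd_add_right (Dvd.intro_left n rfl)]
      constructor
      · intro h; have := Nat.le_of_dvd (by omega) h; omega
      · rintro rfl; rw [Nat.sub_add_cancel hq]
    have e2 : q ∣ (q - p) + (n * q + r + 1) ↔ r = p - 1 := by
      rw [show (q - p) + (n * q + r + 1) = n * q + (q - p + r + 1) by ring,
        Nat.dvd_add_right (Dvd.intro_left n rfl)]
      constructor
      · rintro ⟨c, hc⟩
        have : c = 1 := by
          have h1 : 0 < c := by
            rcases Nat.eq_zero_or_pos c with rfl | h
            · omega
            · exact h
          have h2 : c < 2 := by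
            by_contra h
            have := Nat.mul_le_mul_left q (not_lt.mp h)
            omega
          omega
        subst this; omega
      · rintro rfl; exact ⟨1, by omega⟩
    simp only [e1, e2, sub_div, ite_div, zero_div]
  rw [Finset.sum_congr rfl key2, Finset.sum_sub_distrib, Finset.sum_ite_eq', Finset.sum_ite_eq',
    if_pos (by simp; omega), if_pos (by simp; omega)]
  have hqc : (q : ℂ) ≠ 0 := by exact_mod_cast hq.ne'
  push_cast [Nat.cast_sub (show 1 ≤ q from hq), Nat.cast_sub (show 1 ≤ p from hp)]
  have h1 : (n : ℂ) + 1 ≠ 0 := by exact_mod_cast n.succ_ne_zero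
  have h2 : (n : ℂ) * q + p ≠ 0 := by
    have : n * q + p ≠ 0 := by omega
    exact_mod_cast this
  have e3 : (n : ℂ) * q + (q - 1) + 1 = (n + 1) * q := by ring
  have e4 : (n : ℂ) * q + (p - 1) + 1 = n * q + p := by ring
  have e5 : (n : ℂ) + p / q = (n * q + p) / q := by field_simp
  rw [e3, e4, e5]
  field_simp

lemma aux_reflect (x : ℝ) (hx : 0 < x) (hx1 : x < 1) :
    deriv Real.Gamma x / Real.Gamma x - deriv Real.Gamma (1 - x) / Real.Gamma (1 - x) =
      - π * (Real.cos (π * x) / Real.sin (π * x)) := by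
  have hd {x : ℝ} (hx : 0 < x) : DifferentiableAt ℝ Real.Gamma x :=
    Real.differentiableAt_Gamma fun m ↦ ne_of_gt
      (by linarith [(Nat.cast_nonneg m : (0:ℝ) ≤ m)])
  have hy : 0 < 1 - x := by linarith
  have hsin : 0 < Real.sin (π * x) := Real.sin_pos_of_pos_of_lt_pi (by positivity)
    (by nlinarith [Real.pi_pos])
  have h1 : HasDerivAt (fun s => Real.Gamma s * Real.Gamma (1 - s))
      (deriv Real.Gamma x * Real.Gamma (1 - x) +
        Real.Gamma x * (deriv Real.Gamma (1 - x) * (-1))) x := by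
    refine (hd hx).hasDerivAt.mul ?_
    refine HasDerivAt.comp x (hd hy).hasDerivAt ?_
    simpa using (hasDerivAt_id x).const_sub 1
  have h2 : HasDerivAt (fun s => π / Real.sin (π * s))
      (-(π * (Real.cos (π * x) * π)) / Real.sin (π * x) ^ 2) x := by
    have h3 : HasDerivAt (fun s => Real.sin (π * s)) (Real.cos (π * x) * π) x := by
      refine (Real.hasDerivAt_sin _).comp x ?_
      simpa using (hasDerivAt_id x).const_mul π
    exact ((hasDerivAt_const x π).div h3 hsin.ne').congr_deriv (by ring)
  rw [show (fun s => Real.Gamma s * Real.Gamma (1 - s)) = fun s => π / Real.sin (π * s) from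
    funext Real.Gamma_mul_Gamma_one_sub] at h1
  have h4 := h1.unique h2
  have h5 := Real.Gamma_mul_Gamma_one_sub x
  have g1 := Real.Gamma_pos_of_pos hx
  have g2 := Real.Gamma_pos_of_pos hy
  have h6 : deriv Real.Gamma x / Real.Gamma x - deriv Real.Gamma (1 - x) / Real.Gamma (1 - x) =
      (deriv Real.Gamma x * Real.Gamma (1 - x) +
        Real.Gamma x * (deriv Real.Gamma (1 - x) * (-1))) / (Real.Gamma x * Real.Gamma (1 - x)) := by
    field_simp; ring
  rw [h6, h4, h5]
  have := Real.pi_pos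
  field_simp

lemma aux_Icc (n : ℕ) (f : ℕ → ℝ) :
    ∑ j ∈ Finset.Icc 1 n, f j = ∑ k ∈ Finset.range n, f (k + 1) := by
  induction n with
  | zero => simp
  | succ n ih => rw [Finset.sum_Icc_succ_top (by omega), ih, Finset.sum_range_succ]

lemma aux_even (p q : ℕ) (hp : 0 < p) (hpq : p < q) :
    (deriv Real.Gamma (p / q) / Real.Gamma (p / q) - deriv Real.Gamma 1 / Real.Gamma 1) +
    (deriv Real.Gamma (1 - p / q) / Real.Gamma (1 - p / q) - deriv Real.Gamma 1 / Real.Gamma 1) =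
    -2 * Real.log q + ∑ j ∈ Finset.Icc 1 (q - 1),
        Real.cos (2 * π * j * p / q) * Real.log (2 - 2 * Real.cos (2 * π * j / q)) := by
  have hq : 0 < q := by omega
  have hqc : (q : ℂ) ≠ 0 := by exact_mod_cast hq.ne'
  have hqr : (q : ℝ) ≠ 0 := by exact_mod_cast hq.ne'
  set w : ℂ := Complex.exp (2 * π * Complex.I / q) with hwdef
  have hw : IsPrimitiveRoot w q := Complex.isPrimitiveRoot_exp q hq.ne'
  have h1 := aux_main p q hp hpq w hw
  have h2 := aux_main (q - p) q (by omega) (by omega) w hw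
  rw [show ((q - p : ℕ) : ℝ) / q = 1 - p / q by
    rw [Nat.cast_sub hpq.le, sub_div, div_self hqr], Nat.sub_sub_self hpq.le] at h2
  have hwp : ∀ m : ℕ, w ^ m = Complex.exp ((2 * π * m / q : ℝ) * Complex.I) := by
    intro m
    rw [hwdef, ← Complex.exp_nat_mul]
    congr 1
    push_cast
    ring
  have hcos : ∀ j : ℕ, w ^ (j * (q - p)) + w ^ (j * p) =
      ((2 * Real.cos (2 * π * j * p / q) : ℝ) : ℂ) := by
    intro j
    have e1 : w ^ (j * (q - p)) * w ^ (j * p) = 1 := by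
      rw [← pow_add, ← mul_add, Nat.sub_add_cancel hpq.le, mul_comm, pow_mul, hw.pow_eq_one,
        one_pow]
    rw [eq_inv_of_mul_eq_one_left e1, hwp, ← Complex.exp_neg]
    push_cast
    rw [Complex.cos, mul_div_cancel₀ _ (two_ne_zero)]
    rw [add_comm]
    congr 2 <;> ring
  have hlog : ∀ j : ℕ, Real.log ‖1 - w ^ j‖ =
      (1 / 2) * Real.log (2 - 2 * Real.cos (2 * π * j / q)) := by
    intro j
    have : ‖1 - w ^ j‖ ^ 2 = 2 - 2 * Real.cos (2 * π * j / q) := by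
      rw [hwp, ← Complex.normSq_eq_norm_sq, Complex.normSq_apply]
      simp only [Complex.sub_re, Complex.sub_im, Complex.exp_ofReal_mul_I_re,
        Complex.exp_ofReal_mul_I_im, Complex.one_re, Complex.one_im]
      nlinarith [Real.sin_sq_add_cos_sq (2 * π * j / q)]
    rw [← this, Real.log_pow]; push_cast; ring
  have h3 := congrArg₂ (· + ·) h1 h2
  simp only [← Finset.sum_add_distrib] at h3
  have h4 := congrArg Complex.re h3
  rw [← Complex.ofReal_add, Complex.ofReal_re, Complex.re_sum] at h4
  rw [h4]
  have h5 : ∀ j : ℕ, ((1 - w ^ (j * (q - p))) * -Complex.log (1 - w ^ j) +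
      (1 - w ^ (j * p)) * -Complex.log (1 - w ^ j)).re =
      -2 * Real.log ‖1 - w ^ j‖ + Real.cos (2 * π * j * p / q) *
        Real.log (2 - 2 * Real.cos (2 * π * j / q)) := by
    intro j
    rw [← add_mul, show (1 - w ^ (j * (q - p))) + (1 - w ^ (j * p)) =
      ((2 - 2 * Real.cos (2 * π * j * p / q) : ℝ) : ℂ) by
        rw [Complex.ofReal_sub, ← hcos]; push_cast; ring, Complex.re_ofReal_mul,
      Complex.neg_re, Complex.log_re, hlog]
    ring
  simp_rw [h5]
  obtain ⟨n, rfl⟩ : ∃ n, q = n + 1 := ⟨q - 1, by omega⟩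
  rw [aux_Icc, Finset.sum_range_succ', Nat.add_sub_cancel, Finset.sum_add_distrib,
    ← Finset.mul_sum]
  have h6 : ∑ k ∈ Finset.range n, Real.log ‖1 - w ^ (k + 1)‖ = Real.log ((n + 1 : ℕ) : ℝ) := by
    rw [← Real.log_prod, ← norm_prod, hw.prod_one_sub_pow_eq_order]
    · congr 1
      rw [← Nat.cast_succ, Complex.norm_natCast]
    · intro k hk
      rw [norm_ne_zero_iff, sub_ne_zero]
      exact (hw.pow_ne_one_of_pos_of_lt k.succ_ne_zero
        (by have := Finset.mem_range.mp hk; omega)).symm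
  rw [h6]
  simp

/-- Gauss's digamma theorem: for coprime integers `0 < p < q`,
`ψ(p/q) − ψ(1) = −log q − (π/2)·cot(πp/q)
  + (1/2)·∑_{j=1}^{q−1} cos(2πjp/q)·log(2 − 2cos(2πj/q))`,
where `ψ = Γ'/Γ` is the digamma function. -/
theorem stmt6 (p q : ℕ) (hp : 0 < p) (hpq : p < q) (hco : Nat.Coprime p q) :
    (deriv Real.Gamma (p / q) / Real.Gamma (p / q)) -
      (deriv Real.Gamma 1 / Real.Gamma 1) =
    -Real.log q - (π / 2) * (Real.cos (π * p / q) / Real.sin (π * p / q)) +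
      (1 / 2) * ∑ j ∈ Finset.Icc 1 (q - 1),
        Real.cos (2 * π * j * p / q) * Real.log (2 - 2 * Real.cos (2 * π * j / q)) := by
  have hq' : (0 : ℝ) < q := by exact_mod_cast hp.trans hpq
  have hp' : (0 : ℝ) < p := by exact_mod_cast hp
  have hpq' : (p : ℝ) < q := by exact_mod_cast hpq
  have h1 := aux_even p q hp hpq
  have h2 := aux_reflect (p / q) (by positivity) ((div_lt_one hq').mpr hpq')
  rw [← mul_div_assoc π (p : ℝ) q] at h2
  linarith
end
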